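/- Let B be a finite nonempty set and M ⊆ ℕ^B an upper set with T ≥ U nonnegative integers. If μ_U(M) ≥ 1/2 then μ_T(M) ≥ T/(T+U) (with convention 0/0 = 1 when T = U = 0). -/

import Mathlib

open Finset

/-- The uniform probability of the event `M` under the uniform distribution on
functions `f : B → ℕ` with `∑ b, f b = T`. -/
noncomputable def uniformProb (B : Type*) [Fintype B] (T : ℕ) (M : Set (B → ℕ)) : ℝ := by
  classical
  exact (((Fintype.piFinset fun _ : B => Finset.range (T + 1)).filter
        (fun f => (∑ b, f b) = T ∧ f ∈ M)).card : ℝ) /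
      (((Fintype.piFinset fun _ : B => Finset.range (T + 1)).filter
        (fun f => (∑ b, f b) = T)).card : ℝ)


lemma arith_step (T m a b a' b' p p' : ℝ) (hT : 1 ≤ T) (hm : 0 < m) (ha : 0 ≤ a) (hab : a ≤ b)
    (hb : b ≤ 1) (h3 : 0 ≤ a') (h5 : 0 ≤ b') (h1 : (T+1)*(1-a')*a ≤ T*(1-a)*a') (h2 : T*(1-b')*b ≤ (T-1)*(1-b)*b')
    (hp : p*(T+m) = m*a+T*b) (hp' : p'*(T+1+m) = m*a'+(T+1)*b') :
    (T+1)*(1-p')*p ≤ T*(1-p)*p' := by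
  have hb0 : 0 ≤ b := ha.trans hab
  rcases hb0.eq_or_lt with h0 | h0
  · have : a = 0 := by linarith
    subst this; subst h0
    have hp0 : p = 0 := by
      have : p * (T+m) = 0 := by linarith
      rcases mul_eq_zero.1 this with h | h
      · exact h
      · linarith
    subst hp0
    have : 0 ≤ p' := by
      by_contra h
      nlinarith [mul_nonneg hm.le h3]
    nlinarith
  · have hα : 0 < T + a := by linarith
    have hβ : 0 < T - 1 + b := by linarith
    have ha' : (T+1)*a/(T+a) ≤ a' := by rw [div_le_iff₀ hα]; nlinarith
    have hb' : T*b/(T-1+b) ≤ b' := by rw [div_le_iff₀ hβ]; nlinarith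
    have hW : 0 < T+1+m := by linarith
    have hTm : 0 < T+m := by linarith
    have hpe : p = (m*a+T*b)/(T+m) := by field_simp; linarith
    have hp0 : 0 ≤ p := by rw [hpe]; positivity
    have hQ : 0 ≤ m*(T*(1+a-b)*(T*(b-a)+a) - a^2*(T+b-1)) + T*b*(1-b)*(T+a) := by
      have e1 : a*(T*a) ≤ (1+a-b)*(T*(T*(b-a)+a)) := by
        apply mul_le_mul <;> nlinarith [mul_nonneg (by linarith : 0 ≤ T) (sub_nonneg.2 hab)]
      have e2 : 0 ≤ T*b*(1-b)*(T+a) := by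
        have : 0 ≤ 1 - b := by linarith
        positivity
      have e3 : 0 ≤ (T*(1+a-b)*(T*(b-a)+a) - a^2*(T+b-1)) := by nlinarith [sq_nonneg a]
      nlinarith [mul_nonneg hm.le e3]
    suffices (T+1)*p ≤ p'*(T+p) by nlinarith
    have k1 : (m*((T+1)*a/(T+a)) + (T+1)*(T*b/(T-1+b)))/(T+1+m) ≤ p' := by
      rw [div_le_iff₀ hW, hp']
      have := mul_le_mul_of_nonneg_left ha' hm.le
      have := mul_le_mul_of_nonneg_left hb' (by linarith : 0 ≤ T+1)
      linarith
    refine le_trans ?_ (mul_le_mul_of_nonneg_right k1 (by linarith))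
    rw [← sub_nonneg]
    have : (m*((T+1)*a/(T+a)) + (T+1)*(T*b/(T-1+b)))/(T+1+m)*(T+p) - (T+1)*p
      = (T+1)*(m*(T*(1+a-b)*(T*(b-a)+a) - a^2*(T+b-1)) + T*b*(1-b)*(T+a)) /((T+a)*(T-1+b)*(T+1+m)*(T+m)) := by
      rw [hpe]
      field_simp
      ring
    rw [this]
    apply div_nonneg <;> [skip; positivity]
    exact mul_nonneg (by linarith) hQ

section pebble
open Classical

/-- level set -/
noncomputable def lev (ι : Type*) [Fintype ι] (T : ℕ) : Finset (ι → ℕ) := piAntidiag univ T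

/-- number of elements of `M` on level `T` -/
noncomputable def cnt {ι : Type*} [Fintype ι] (M : Set (ι → ℕ)) (T : ℕ) : ℕ :=
  ∑ f ∈ lev ι T, if f ∈ M then 1 else 0

variable {ι : Type*} [Fintype ι] [DecidableEq ι]

lemma mem_lev {T : ℕ} {f : ι → ℕ} : f ∈ lev ι T ↔ ∑ i, f i = T := by
  simp [lev]

lemma cnt_univ (T : ℕ) : cnt (Set.univ : Set (ι → ℕ)) T = #(lev ι T) := by
  simp [cnt]

lemma cnt_mono {M N : Set (ι → ℕ)} (T : ℕ) (h : ∀ f ∈ lev ι T, f ∈ M → f ∈ N) :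
    cnt M T ≤ cnt N T := by
  unfold cnt
  apply sum_le_sum
  intro f hf
  have := h f hf
  split_ifs <;> simp_all

lemma sum_single_add (f : ι → ℕ) (j : ι) : ∑ i, (f + Pi.single j 1 : ι → ℕ) i = (∑ i, f i) + 1 := by
  simp [sum_add_distrib, Pi.single_apply]

lemma sum_shift (T : ℕ) (j : ι) (w : (ι → ℕ) → ℕ) :
    ∑ f ∈ (lev ι (T+1)).filter (fun f => f j ≠ 0), w f
      = ∑ h ∈ lev ι T, w (h + Pi.single j 1) := by
  symm
  apply sum_bij (fun h _ => h + Pi.single j 1)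
  · intro h hh
    rw [mem_lev] at hh
    rw [mem_filter, mem_lev, sum_single_add, hh]
    simp
  · intro a _ b _ h
    simpa using h
  · intro f hf
    rw [mem_filter, mem_lev] at hf
    have e : f - Pi.single j 1 + Pi.single j 1 = f := by
      funext i
      by_cases hi : i = j
      · subst hi
        have := hf.2
        simp; omega
      · simp [hi]
    refine ⟨f - Pi.single j 1, ?_, e⟩
    rw [mem_lev]
    have := sum_single_add (f - Pi.single j 1) j
    rw [e] at this
    omega
  · intros; rfl

lemma sum_shift_mul (T : ℕ) (j : ι) (w : (ι → ℕ) → ℕ) :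
    ∑ f ∈ lev ι (T+1), f j * w f
      = ∑ h ∈ lev ι T, (h j + 1) * w (h + Pi.single j 1) := by
  have := sum_shift T j (fun f => f j * w f)
  simp only [Pi.add_apply, Pi.single_eq_same] at this
  rw [← this, sum_filter]
  apply sum_congr rfl
  intro f _
  by_cases h : f j = 0 <;> simp [h]

lemma cnt_weight (M : Set (ι → ℕ)) (T : ℕ) :
    T * cnt M T = ∑ j, ∑ f ∈ lev ι T, f j * (if f ∈ M then 1 else 0) := by
  rw [sum_comm, cnt, mul_sum]
  apply sum_congr rfl
  intro f hf
  rw [← sum_mul, mem_lev.1 hf]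

lemma cnt_weight' (M : Set (ι → ℕ)) (T : ℕ) :
    (T + Fintype.card ι) * cnt M T =
      ∑ j, ∑ f ∈ lev ι T, (f j + 1) * (if f ∈ M then 1 else 0) := by
  rw [sum_comm, cnt, mul_sum]
  apply sum_congr rfl
  intro f hf
  rw [← sum_mul, sum_add_distrib, mem_lev.1 hf]
  simp

lemma cnt_shadow (G H : Set (ι → ℕ)) (T : ℕ)
    (h : ∀ f ∈ lev ι T, ∀ j, f + Pi.single j 1 ∈ G → f ∈ H) :
    (T + 1) * cnt G (T+1) ≤ (T + Fintype.card ι) * cnt H T := by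
  rw [cnt_weight, cnt_weight']
  apply sum_le_sum
  intro j _
  rw [sum_shift_mul]
  apply sum_le_sum
  intro f hf
  apply Nat.mul_le_mul_left
  have := h f hf j
  split_ifs <;> simp_all

lemma card_lev_succ (T : ℕ) :
    (T + 1) * #(lev ι (T+1)) = (T + Fintype.card ι) * #(lev ι T) := by
  rw [← cnt_univ, ← cnt_univ, cnt_weight, cnt_weight']
  apply sum_congr rfl
  intro j _
  rw [sum_shift_mul]
  simp

lemma card_lev_pos [Nonempty ι] (T : ℕ) : 0 < #(lev ι T) := by
  rw [card_pos]
  obtain ⟨i⟩ := ‹Nonempty ι›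
  exact ⟨Pi.single i T, by simp [mem_lev]⟩

lemma cnt_le (M : Set (ι → ℕ)) (T : ℕ) : cnt M T ≤ #(lev ι T) := by
  rw [← cnt_univ]; exact cnt_mono T (by simp)

/-- density -/
noncomputable def pden (M : Set (ι → ℕ)) (T : ℕ) : ℝ := (cnt M T : ℝ) / #(lev ι T)

lemma pden_nonneg (M : Set (ι → ℕ)) (T : ℕ) : 0 ≤ pden M T := by unfold pden; positivity

lemma pden_le_one (M : Set (ι → ℕ)) (T : ℕ) : pden M T ≤ 1 := by
  unfold pden
  apply div_le_one_of_le₀ _ (by positivity)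
  exact_mod_cast cnt_le M T

lemma pden_shadow [Nonempty ι] (G H : Set (ι → ℕ)) (T : ℕ)
    (h : ∀ f ∈ lev ι T, ∀ j, f + Pi.single j 1 ∈ G → f ∈ H) :
    pden G (T+1) ≤ pden H T := by
  have h1 := cnt_shadow G H T h
  have h2 := card_lev_succ (ι := ι) T
  have p1 := card_lev_pos (ι := ι) T
  have p2 := card_lev_pos (ι := ι) (T+1)
  unfold pden
  rw [div_le_div_iff₀ (by exact_mod_cast p2) (by exact_mod_cast p1)]
  norm_cast
  apply Nat.le_of_mul_le_mul_left _ (show 0 < T + 1 by omega)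
  calc (T+1) * (cnt G (T+1) * #(lev ι T)) = ((T+1) * cnt G (T+1)) * #(lev ι T) := by ring
    _ ≤ ((T + Fintype.card ι) * cnt H T) * #(lev ι T) := Nat.mul_le_mul_right _ h1
    _ = cnt H T * ((T + Fintype.card ι) * #(lev ι T)) := by ring
    _ = cnt H T * ((T + 1) * #(lev ι (T+1))) := by rw [h2]
    _ = _ := by ring

/-! slices -/

/-- slice at zero -/
def slice0 {m : ℕ} (M : Set (Fin (m+1) → ℕ)) : Set (Fin m → ℕ) :=
  {g | (Fin.cons 0 g : Fin (m+1) → ℕ) ∈ M}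

/-- quotient by the first variable -/
def quot0 {m : ℕ} (M : Set (Fin (m+1) → ℕ)) : Set (Fin (m+1) → ℕ) :=
  {f | f + Pi.single 0 1 ∈ M}

lemma mem_slice0 {m : ℕ} (M : Set (Fin (m+1) → ℕ)) (g : Fin m → ℕ) :
    g ∈ slice0 M ↔ (Fin.cons 0 g : Fin (m+1) → ℕ) ∈ M := Iff.of_eq (Set.mem_ofPred_eq ..)

lemma mem_quot0 {m : ℕ} (M : Set (Fin (m+1) → ℕ)) (f : Fin (m+1) → ℕ) :
    f ∈ quot0 M ↔ f + Pi.single 0 1 ∈ M := Iff.of_eq (Set.mem_ofPred_eq ..)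

lemma sum_slice0 {m : ℕ} (T : ℕ) (w : (Fin (m+1) → ℕ) → ℕ) :
    ∑ f ∈ (lev (Fin (m+1)) T).filter (fun f => ¬ (f 0 ≠ 0)), w f
      = ∑ g ∈ lev (Fin m) T, w (Fin.cons 0 g) := by
  symm
  apply sum_bij (fun g _ => (Fin.cons 0 g : Fin (m+1) → ℕ))
  · intro g hg
    rw [mem_lev] at hg
    simp [mem_filter, mem_lev, Fin.sum_univ_succ, hg]
  · intro a _ b _ h
    exact (Fin.cons_inj.1 h).2
  · intro f hf
    rw [mem_filter, mem_lev, Fin.sum_univ_succ] at hf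
    have h0 : f 0 = 0 := by simpa using hf.2
    refine ⟨Fin.tail f, ?_, ?_⟩
    · rw [mem_lev]
      have := hf.1
      rw [h0] at this
      simpa [Fin.tail] using this
    · rw [← h0]; exact Fin.cons_self_tail f
  · intros; rfl

lemma cnt_split {m : ℕ} (M : Set (Fin (m+1) → ℕ)) (T : ℕ) :
    cnt M (T+1) = cnt (slice0 M) (T+1) + cnt (quot0 M) T := by
  unfold cnt
  rw [← sum_filter_add_sum_filter_not (lev (Fin (m+1)) (T+1)) (fun f => f 0 ≠ 0), sum_shift,
    sum_slice0, add_comm]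
  simp only [mem_slice0, mem_quot0]

lemma pden_split {m : ℕ} [NeZero m] (M : Set (Fin (m+1) → ℕ)) (T : ℕ) :
    pden M (T+1) * ((T:ℝ)+1+m) = m * pden (slice0 M) (T+1) + (T+1) * pden (quot0 M) T := by
  have h := cnt_split M T
  have h2 := cnt_split (Set.univ : Set (Fin (m+1) → ℕ)) T
  have e1 : slice0 (Set.univ : Set (Fin (m+1) → ℕ)) = Set.univ := by ext; simp [slice0]
  have e2 : quot0 (Set.univ : Set (Fin (m+1) → ℕ)) = Set.univ := by ext; simp [quot0]
  rw [e1, e2, cnt_univ, cnt_univ, cnt_univ] at h2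
  have h3 := card_lev_succ (ι := Fin (m+1)) T
  rw [Fintype.card_fin] at h3
  have p1 := card_lev_pos (ι := Fin (m+1)) T
  have p2 := card_lev_pos (ι := Fin (m+1)) (T+1)
  have p3 := card_lev_pos (ι := Fin m) (T+1)
  unfold pden
  rw [h]
  have h2' : (#(lev (Fin (m+1)) (T+1)) : ℝ) = #(lev (Fin m) (T+1)) + #(lev (Fin (m+1)) T) := by
    exact_mod_cast h2
  have h3' : ((T:ℝ)+1) * #(lev (Fin (m+1)) (T+1)) = (T+(m+1)) * #(lev (Fin (m+1)) T) := by
    exact_mod_cast h3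
  have q1 : (0:ℝ) < #(lev (Fin (m+1)) T) := by exact_mod_cast p1
  have q2 : (0:ℝ) < #(lev (Fin (m+1)) (T+1)) := by exact_mod_cast p2
  have q3 : (0:ℝ) < #(lev (Fin m) (T+1)) := by exact_mod_cast p3
  generalize (#(lev (Fin (m+1)) T) : ℝ) = x at *
  generalize (#(lev (Fin (m+1)) (T+1)) : ℝ) = y at *
  generalize (#(lev (Fin m) (T+1)) : ℝ) = z at *
  push_cast
  have k1 : ((T:ℝ)+1+m) / y = m / z := by
    rw [div_eq_div_iff q2.ne' q3.ne']
    have : z = y - x := by linarith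
    rw [this]; linarith
  have k2 : ((T:ℝ)+1+m) / y = (T+1) / x := by
    rw [div_eq_div_iff q2.ne' q1.ne']; linarith
  generalize (cnt (slice0 M) (T+1) : ℝ) = u
  generalize (cnt (quot0 M) T : ℝ) = v
  calc (u+v)/y * ((T:ℝ)+1+m) = u * (((T:ℝ)+1+m) / y) + v * (((T:ℝ)+1+m) / y) := by ring
    _ = u * (m / z) + v * ((T+1)/x) := by rw [k1, ← k2, k1]
    _ = _ := by ring

/-- stability of level `T` under moving a pebble to position `0` -/
def Stab {m : ℕ} (M : Set (Fin (m+1) → ℕ)) (T : ℕ) : Prop :=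
  ∀ f : Fin (m+1) → ℕ, ∀ j, ∑ i, f i + 1 = T → f + Pi.single j 1 ∈ M → f + Pi.single 0 1 ∈ M

lemma stab_quot {m : ℕ} (M : Set (Fin (m+1) → ℕ)) (T : ℕ) (h : Stab M (T+1)) :
    Stab (quot0 M) T := by
  intro f j hf hM
  rw [mem_quot0] at *
  have := h (f + Pi.single 0 1) j (by have := sum_single_add f 0; omega)
    (by rw [add_right_comm]; exact hM)
  exact this

lemma stab_pden {m : ℕ} [NeZero m] (T : ℕ) : ∀ M : Set (Fin (m+1) → ℕ), Stab M T →
    pden (slice0 M) T ≤ pden M T := by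
  induction T with
  | zero =>
    intro M _
    have e : ∀ (k : ℕ), lev (Fin k) 0 = {0} := by intro k; simp [lev]
    have : (Fin.cons 0 (0 : Fin m → ℕ) : Fin (m+1) → ℕ) = 0 := by
      funext i; refine Fin.cases ?_ ?_ i <;> simp
    simp [pden, cnt, e, mem_slice0, this, filter_singleton]
    split_ifs <;> simp
  | succ T ih =>
    intro M hM
    have h1 := ih (quot0 M) (stab_quot M T hM)
    have h2 : pden (slice0 M) (T+1) ≤ pden (slice0 (quot0 M)) T := by
      apply pden_shadow
      intro f hf j hj
      rw [mem_lev] at hf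
      have := hM (Fin.cons 0 f) j.succ (by simp [Fin.sum_univ_succ, hf]) (by
        have hj' : (Fin.cons 0 (f + Pi.single j 1) : Fin (m+1) → ℕ) ∈ M := (mem_slice0 _ _).1 hj
        convert hj' using 1
        funext i
        refine Fin.cases ?_ (fun i => ?_) i
        · simp
        · by_cases hij : i = j <;> simp [hij] )
      rw [mem_slice0, mem_quot0]
      exact this
    have h3 := pden_split M T
    have hm : (0:ℝ) < m := by exact_mod_cast Nat.pos_of_ne_zero (NeZero.ne m)
    have h4 : pden (slice0 M) (T+1) ≤ pden (quot0 M) T := h2.trans h1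
    have : pden (slice0 M) (T+1) * ((T:ℝ)+1+m) ≤ pden M (T+1) * ((T:ℝ)+1+m) := by
      rw [h3]
      have := mul_le_mul_of_nonneg_left h4 (by positivity : (0:ℝ) ≤ T+1)
      linarith
    exact le_of_mul_le_mul_right this (by positivity)

lemma stab_pden' {m : ℕ} [NeZero m] (T : ℕ) (M : Set (Fin (m+1) → ℕ)) (hM : Stab M (T+1)) :
    pden (slice0 M) (T+1) ≤ pden (quot0 M) T := by
  have h1 := stab_pden (T+1) M hM
  have h3 := pden_split M T
  have hm : (0:ℝ) < m := by exact_mod_cast Nat.pos_of_ne_zero (NeZero.ne m)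
  have : pden (slice0 M) (T+1) * ((T:ℝ)+1) ≤ pden (quot0 M) T * ((T:ℝ)+1) := by
    have := mul_le_mul_of_nonneg_right h1 (by positivity : (0:ℝ) ≤ T+1+m)
    linarith
  exact le_of_mul_le_mul_right this (by positivity)

/-! compression -/

/-- point number `i` on the line through `f` in directions `z`, `j` -/
noncomputable def ln (z j : ι) (f : ι → ℕ) (i : ℕ) : ι → ℕ :=
  Function.update (Function.update f j i) z (f z + f j - i)

/-- positions of the members of `M` on the line -/
noncomputable def sset (z j : ι) (M : Set (ι → ℕ)) (f : ι → ℕ) : Finset ℕ :=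
  (range (f z + f j + 1)).filter (fun i => ln z j f i ∈ M)

/-- compression -/
def cset (z j : ι) (M : Set (ι → ℕ)) : Set (ι → ℕ) := {f | f j < #(sset z j M f)}

lemma ln_z (z j : ι) (f : ι → ℕ) (i : ℕ) : ln z j f i z = f z + f j - i := by simp [ln]

lemma ln_j {z j : ι} (h : j ≠ z) (f : ι → ℕ) (i : ℕ) : ln z j f i j = i := by simp [ln, h]

lemma ln_o {z j k : ι} (h : k ≠ z) (h' : k ≠ j) (f : ι → ℕ) (i : ℕ) : ln z j f i k = f k := by
  simp [ln, h, h']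

lemma ln_self {z j : ι} (f : ι → ℕ) : ln z j f (f j) = f := by
  funext k
  by_cases hz : k = z
  · subst hz; rw [ln_z]; omega
  by_cases hj : k = j
  · subst hj; rw [ln_j hz]
  rw [ln_o hz hj]

lemma ln_ln {z j : ι} (h : j ≠ z) (f : ι → ℕ) (i i' : ℕ) (hi : i ≤ f z + f j) :
    ln z j (ln z j f i) i' = ln z j f i' := by
  funext k
  by_cases hz : k = z
  · subst hz; rw [ln_z, ln_z, ln_z, ln_j h]; omega
  by_cases hj : k = j
  · subst hj; rw [ln_j h, ln_j h]
  rw [ln_o hz hj, ln_o hz hj, ln_o hz hj]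

lemma sset_ln {z j : ι} (h : j ≠ z) (M : Set (ι → ℕ)) (f : ι → ℕ) (i : ℕ)
    (hi : i ≤ f z + f j) : sset z j M (ln z j f i) = sset z j M f := by
  unfold sset
  rw [ln_z, ln_j h, Nat.sub_add_cancel hi]
  simp only [ln_ln h f i _ hi]

lemma sum_ln {z j : ι} (h : j ≠ z) (f : ι → ℕ) (i : ℕ)
    (hi : i ≤ f z + f j) : ∑ k, ln z j f i k = ∑ k, f k := by
  have key : ∀ g : ι → ℕ, ∑ k, g k = g z + (g j + ∑ k ∈ (univ.erase z).erase j, g k) := by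
    intro g
    rw [add_sum_erase (univ.erase z) g (by simp [h]), add_sum_erase univ g (by simp)]
  rw [key, key f, ln_z, ln_j h]
  have : ∑ k ∈ (univ.erase z).erase j, ln z j f i k = ∑ k ∈ (univ.erase z).erase j, f k := by
    apply sum_congr rfl
    intro k hk
    simp only [mem_erase, mem_univ, and_true] at hk
    exact ln_o hk.2 hk.1 f i
  rw [this]; omega

lemma sum_lines {z j : ι} (h : j ≠ z) (T : ℕ) (F : (ι → ℕ) → ℕ) :
    ∑ f ∈ lev ι T, F f = ∑ r ∈ (lev ι T).filter (fun r => r j = 0),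
      ∑ i ∈ range (r z + 1), F (ln z j r i) := by
  rw [sum_sigma']
  symm
  apply sum_bij' (i := fun (x : (_ : ι → ℕ) × ℕ) _ => ln z j x.1 x.2)
    (j := fun f _ => (⟨ln z j f 0, f j⟩ : (_ : ι → ℕ) × ℕ))
  · rintro ⟨r, i⟩ hx
    simp only [mem_sigma, mem_filter, mem_range, mem_lev] at hx ⊢
    rw [sum_ln h _ _ (by omega)]
    exact hx.1.1
  · intro f hf
    simp only [mem_sigma, mem_filter, mem_range, mem_lev] at hf ⊢
    rw [sum_ln h _ _ (by omega), ln_j h, ln_z]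
    exact ⟨⟨hf, rfl⟩, by omega⟩
  · rintro ⟨r, i⟩ hx
    simp only [mem_sigma, mem_filter, mem_range, mem_lev] at hx ⊢
    have e : ln z j r 0 = r := by
      conv_rhs => rw [← ln_self (z := z) (j := j) r, hx.1.2]
    rw [ln_ln h _ _ _ (by omega), ln_j h, e]
  · intro f hf
    dsimp only
    rw [ln_ln h _ _ _ (by omega), ln_self]
  · intros; rfl

lemma sset_eq {z j : ι} (M : Set (ι → ℕ)) (r : ι → ℕ) (hr : r j = 0) :
    sset z j M r = (range (r z + 1)).filter (fun i => ln z j r i ∈ M) := by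
  unfold sset; rw [hr, add_zero]

lemma card_sset {z j : ι} (M : Set (ι → ℕ)) (r : ι → ℕ) (hr : r j = 0) :
    #(sset z j M r) ≤ r z + 1 := by
  rw [sset_eq M r hr]
  exact (card_filter_le _ _).trans (by simp)

lemma mem_cset_ln {z j : ι} (h : j ≠ z) (M : Set (ι → ℕ)) (r : ι → ℕ) (hr : r j = 0) (i : ℕ)
    (hi : i ≤ r z) : ln z j r i ∈ cset z j M ↔ i < #(sset z j M r) := by
  unfold cset
  rw [Set.mem_ofPred_eq, sset_ln h _ _ _ (by omega), ln_j h]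

lemma sset_cset {z j : ι} (h : j ≠ z) (M : Set (ι → ℕ)) (r : ι → ℕ) (hr : r j = 0) :
    (range (r z + 1)).filter (fun i => ln z j r i ∈ cset z j M) = range #(sset z j M r) := by
  have := card_sset (z := z) M r hr
  ext i
  simp only [mem_filter, mem_range]
  constructor
  · rintro ⟨h1, h2⟩
    rwa [mem_cset_ln h M r hr i (by omega)] at h2
  · intro hi
    refine ⟨by omega, ?_⟩
    rwa [mem_cset_ln h M r hr i (by omega)]

lemma cnt_cset {z j : ι} (h : j ≠ z) (M : Set (ι → ℕ)) (T : ℕ) :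
    cnt (cset z j M) T = cnt M T := by
  unfold cnt
  rw [sum_lines h, sum_lines h T (fun f => if f ∈ M then 1 else 0)]
  apply sum_congr rfl
  intro r hr
  rw [mem_filter] at hr
  rw [← sum_filter, ← sum_filter, sset_cset h M r hr.2, ← sset_eq M r hr.2]
  simp

lemma upset_cset {z j : ι} (h : j ≠ z) (M : Set (ι → ℕ))
    (hM : ∀ x ∈ M, ∀ y : ι → ℕ, x ≤ y → y ∈ M) :
    ∀ x ∈ cset z j M, ∀ y : ι → ℕ, x ≤ y → y ∈ cset z j M := by
  intro f hf g hfg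
  unfold cset at *
  rw [Set.mem_ofPred_eq] at *
  have hz : f z ≤ g z := hfg z
  have hj : f j ≤ g j := hfg j
  have key : ∀ i ∈ sset z j M f, ∀ t, t ≤ (g z + g j) - (f z + f j) → i + t ∈ sset z j M g := by
    intro i hi t ht
    unfold sset at *
    rw [mem_filter, mem_range] at *
    refine ⟨by omega, hM _ hi.2 _ ?_⟩
    intro k
    show ln z j f i k ≤ ln z j g (i + t) k
    by_cases hkz : k = z
    · subst hkz; rw [ln_z, ln_z]; omega
    by_cases hkj : k = j
    · subst hkj; rw [ln_j h, ln_j h]; omega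
    rw [ln_o hkz hkj, ln_o hkz hkj]; exact hfg k
  have hne : (sset z j M f).Nonempty := by rw [← card_pos]; omega
  set D := (g z + g j) - (f z + f j) with hD
  set mx := (sset z j M f).max' hne with hmx
  have hdis : Disjoint (sset z j M f) (Ioc mx (mx + D)) := by
    rw [disjoint_left]
    intro a ha hb
    have := le_max' _ a ha
    rw [mem_Ioc] at hb
    omega
  have hsub : sset z j M f ∪ Ioc mx (mx + D) ⊆ sset z j M g := by
    intro a ha
    rw [mem_union] at ha
    rcases ha with ha | ha
    · exact key a ha 0 (by omega)
    · rw [mem_Ioc] at ha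
      have := key mx (max'_mem _ hne) (a - mx) (by omega)
      rwa [show mx + (a - mx) = a by omega] at this
  have := card_le_card hsub
  rw [card_union_of_disjoint hdis, Nat.card_Ioc] at this
  omega

lemma sum_range_le_aux (S : Finset ℕ) : ∑ i ∈ range #S, i ≤ ∑ i ∈ S, i ∧
    (S ≠ range #S → ∑ i ∈ range #S, i < ∑ i ∈ S, i) := by
  set R := range #S with hR
  have hc : #R = #S := by simp [hR]
  have e1 := sum_inter_add_sum_sdiff S R (fun i => i)
  have e2 := sum_inter_add_sum_sdiff R S (fun i => i)
  have c1 : #(S \ R) = #(R \ S) := card_sdiff_comm hc.symm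
  have l1 : #(S \ R) * #S ≤ ∑ i ∈ S \ R, i := by
    rw [← smul_eq_mul]
    apply card_nsmul_le_sum
    intro x hx
    simp [hR] at hx
    exact hx.2
  have l2 : ∑ i ∈ R \ S, (i + 1) ≤ #(R \ S) * #S := by
    rw [← smul_eq_mul]
    apply sum_le_card_nsmul
    intro x hx
    simp [hR] at hx
    exact hx.1
  rw [sum_add_distrib, sum_const, smul_eq_mul, mul_one] at l2
  rw [inter_comm] at e2
  rw [c1] at l1
  refine ⟨by omega, fun hne => ?_⟩
  have : 0 < #(R \ S) := by
    rw [card_pos, sdiff_nonempty]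
    intro hsub
    exact hne (eq_of_subset_of_card_le hsub hc.symm.le).symm
  omega

/-- potential -/
noncomputable def pot (z : ι) (T : ℕ) (M : Set (ι → ℕ)) : ℕ :=
  ∑ f ∈ lev ι T, if f ∈ M then T - f z else 0

lemma pot_eq {z j : ι} (h : j ≠ z) (M : Set (ι → ℕ)) (T : ℕ) :
    pot z T M = ∑ r ∈ (lev ι T).filter (fun r => r j = 0),
      ∑ i ∈ (range (r z + 1)).filter (fun i => ln z j r i ∈ M), ((T - r z) + i) := by
  unfold pot
  rw [sum_lines h]
  apply sum_congr rfl
  intro r hr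
  rw [mem_filter, mem_lev] at hr
  have hz : r z ≤ T := by
    rw [← hr.1]; exact single_le_sum (f := r) (fun _ _ => Nat.zero_le _) (mem_univ z)
  rw [← sum_filter]
  apply sum_congr rfl
  intro i hi
  rw [mem_filter, mem_range] at hi
  rw [ln_z, hr.2]
  omega

lemma pot_cset {z j : ι} (h : j ≠ z) (M : Set (ι → ℕ)) (T : ℕ) (r : ι → ℕ) (hr : r ∈ lev ι T)
    (hrj : r j = 0) (hne : sset z j M r ≠ range #(sset z j M r)) :
    pot z T (cset z j M) < pot z T M := by
  rw [pot_eq h, pot_eq h M]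
  have aux : ∀ r : ι → ℕ, r j = 0 →
    (∑ i ∈ (range (r z + 1)).filter (fun i => ln z j r i ∈ cset z j M), ((T - r z) + i)
      = #(sset z j M r) * (T - r z) + ∑ i ∈ range #(sset z j M r), i) ∧
    (∑ i ∈ (range (r z + 1)).filter (fun i => ln z j r i ∈ M), ((T - r z) + i)
      = #(sset z j M r) * (T - r z) + ∑ i ∈ sset z j M r, i) := by
    intro r hr
    rw [sset_cset h M r hr, ← sset_eq M r hr, sum_add_distrib, sum_add_distrib]
    simp
  apply sum_lt_sum
  · intro r hr
    rw [mem_filter] at hr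
    rw [(aux r hr.2).1, (aux r hr.2).2]
    have := (sum_range_le_aux (sset z j M r)).1
    omega
  · refine ⟨r, by simp [hr, hrj], ?_⟩
    rw [(aux r hrj).1, (aux r hrj).2]
    have := (sum_range_le_aux (sset z j M r)).2 hne
    omega

lemma exists_stab {m : ℕ} (T : ℕ) : ∀ (N : ℕ) (M : Set (Fin (m+1) → ℕ)), pot 0 T M = N →
    (∀ x ∈ M, ∀ y : Fin (m+1) → ℕ, x ≤ y → y ∈ M) →
    ∃ M' : Set (Fin (m+1) → ℕ), (∀ x ∈ M', ∀ y : Fin (m+1) → ℕ, x ≤ y → y ∈ M') ∧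
      Stab M' T ∧ ∀ t, cnt M' t = cnt M t := by
  intro N
  induction N using Nat.strong_induction_on with
  | _ N ih =>
  intro M hN hM
  by_cases hs : Stab M T
  · exact ⟨M, hM, hs, fun _ => rfl⟩
  unfold Stab at hs
  push Not at hs
  obtain ⟨f, j, hf, h1, h2⟩ := hs
  have hj : j ≠ 0 := by
    rintro rfl
    exact h2 h1
  set g : Fin (m+1) → ℕ := f + Pi.single j 1 with hg
  have gz : g 0 = f 0 := by simp [hg, hj.symm]
  have gj : g j = f j + 1 := by simp [hg]
  have hlt : pot 0 T (cset 0 j M) < pot 0 T M := by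
    apply pot_cset hj M T (ln 0 j g 0)
    · rw [mem_lev, sum_ln hj _ _ (by omega), hg, sum_single_add, hf]
    · rw [ln_j hj]
    · rw [sset_ln hj _ _ _ (by omega)]
      intro he
      have m1 : f j + 1 ∈ sset 0 j M g := by
        unfold sset
        rw [mem_filter, mem_range, ← gj, ln_self]
        exact ⟨by omega, h1⟩
      have m2 : f j ∉ sset 0 j M g := by
        unfold sset
        rw [mem_filter]
        rintro ⟨_, h3⟩
        apply h2
        convert h3 using 1
        funext k
        by_cases hz : k = 0
        · subst hz; rw [ln_z, gz, gj]; simp; omega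
        by_cases hkj : k = j
        · subst hkj; rw [ln_j hj]; simp [hj]
        rw [ln_o hz hkj]; simp [hg, hz, hkj]
      rw [he, mem_range] at m1 m2
      omega
  obtain ⟨M', a1, a2, a3⟩ := ih _ (hN ▸ hlt) (cset 0 j M) rfl (upset_cset hj M hM)
  exact ⟨M', a1, a2, fun t => (a3 t).trans (cnt_cset hj M t)⟩

/-! main induction -/

lemma main_zero [Nonempty ι] (M : Set (ι → ℕ)) (hM : ∀ x ∈ M, ∀ y : ι → ℕ, x ≤ y → y ∈ M)
    (h : pden M 0 ≠ 0) (T : ℕ) : pden M T = 1 := by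
  have h0 : (0 : ι → ℕ) ∈ M := by
    by_contra hn
    apply h
    simp [pden, cnt, lev, hn]
  have : M = Set.univ := by
    ext f
    simp only [Set.mem_univ, iff_true]
    exact hM 0 h0 f (fun _ => Nat.zero_le _)
  have hp := card_lev_pos (ι := ι) T
  rw [this, pden, cnt_univ, div_self]
  exact_mod_cast hp.ne'

lemma main_fin (m : ℕ) : ∀ (T : ℕ) (M : Set (Fin (m+1) → ℕ)),
    (∀ x ∈ M, ∀ y : Fin (m+1) → ℕ, x ≤ y → y ∈ M) →
    ((T:ℝ)+1)*(1 - pden M (T+1)) * pden M T ≤ T*(1-pden M T)*pden M (T+1) := by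
  induction m with
  | zero =>
    intro T M hM
    have e : ∀ t, lev (Fin 1) t = {fun _ => t} := by
      intro t
      ext f
      rw [mem_lev, mem_singleton]
      constructor
      · intro h; funext i; rw [Subsingleton.elim i 0]; simpa using h
      · rintro rfl; simp
    have hd : ∀ t, pden M t = if (fun _ => t) ∈ M then 1 else 0 := by
      intro t; simp [pden, cnt, e, filter_singleton]; split_ifs <;> simp
    rw [hd, hd]
    by_cases h : (fun _ => T) ∈ M
    · have : (fun _ => T+1) ∈ M := hM _ h _ (fun _ => Nat.le_succ T)
      simp [h, this]
    · simp only [h, if_false]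
      split_ifs <;> simp
  | succ m ih =>
    intro T
    induction T with
    | zero =>
      intro M hM
      by_cases h : pden M 0 = 0
      · simp [h]
      · rw [main_zero M hM h 0, main_zero M hM h (0+1)]; simp
    | succ T ihT =>
      intro M₀ hM₀
      obtain ⟨M, hM, hs, hc⟩ := exists_stab (T+1) _ M₀ rfl hM₀
      have hd : ∀ t, pden M₀ t = pden M t := by intro t; simp [pden, hc]
      rw [hd, hd]
      have a1 := ih (T+1) (slice0 M) (by
        intro x hx y hxy
        rw [mem_slice0] at *
        refine hM _ hx _ ?_
        intro k
        refine Fin.cases ?_ (fun k => ?_) k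
        · simp
        · simpa using hxy k)
      have a2 := ihT (quot0 M) (by
        intro x hx y hxy
        rw [mem_quot0] at *
        refine hM _ hx _ ?_
        intro k
        have := hxy k
        simpa using this)
      have s1 := pden_split M T
      have s2 := pden_split M (T+1)
      push_cast at *
      apply arith_step ((T:ℝ)+1) ((m:ℝ)+1) (pden (slice0 M) (T+1)) (pden (quot0 M) T)
        (pden (slice0 M) (T+1+1)) (pden (quot0 M) (T+1))
      · linarith [(Nat.cast_nonneg T : (0:ℝ) ≤ T)]
      · positivity
      · exact pden_nonneg _ _
      · exact stab_pden' T M hs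
      · exact pden_le_one _ _
      · exact pden_nonneg _ _
      · exact pden_nonneg _ _
      · exact a1
      · simpa using a2
      · linarith
      · linarith

lemma pden_equiv {κ : Type*} [Fintype κ] (e : ι ≃ κ) (M : Set (ι → ℕ)) (T : ℕ) :
    pden M T = pden {g : κ → ℕ | g ∘ e ∈ M} T := by
  have key : ∀ w : (ι → ℕ) → ℕ, ∑ f ∈ lev ι T, w f = ∑ g ∈ lev κ T, w (g ∘ e) := by
    intro w
    apply sum_bij' (i := fun f _ => f ∘ e.symm) (j := fun g _ => g ∘ e)
    · intro f hf
      rw [mem_lev] at *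
      rw [← hf]; exact Equiv.sum_comp e.symm f
    · intro f hf
      rw [mem_lev] at *
      rw [← hf]; exact Equiv.sum_comp e f
    · intro f _; funext i; simp
    · intro f _; funext i; simp
    · intro f _; congr 1; funext i; simp
  have h1 := key (fun _ => 1)
  simp only [sum_const, smul_eq_mul, mul_one] at h1
  unfold pden cnt
  rw [key, h1]
  simp only [Set.mem_ofPred_eq]

lemma main_gen [Nonempty ι] (T : ℕ) (M : Set (ι → ℕ))
    (hM : ∀ x ∈ M, ∀ y : ι → ℕ, x ≤ y → y ∈ M) :
    ((T:ℝ)+1)*(1 - pden M (T+1)) * pden M T ≤ T*(1-pden M T)*pden M (T+1) := by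
  obtain ⟨m, hm⟩ := Nat.exists_eq_succ_of_ne_zero (Fintype.card_ne_zero (α := ι))
  have e : ι ≃ Fin (m+1) := Fintype.equivFinOfCardEq hm
  rw [pden_equiv e, pden_equiv e]
  apply main_fin
  intro x hx y hxy
  rw [Set.mem_ofPred_eq] at *
  exact hM _ hx _ (fun k => hxy (e k))

lemma chain [Nonempty ι] (M : Set (ι → ℕ))
    (hM : ∀ x ∈ M, ∀ y : ι → ℕ, x ≤ y → y ∈ M) (U T : ℕ) (hUT : U ≤ T)
    (h : 1/2 ≤ pden M U) : 0 < pden M T ∧ T * (1 - pden M T) ≤ U * pden M T := by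
  induction T, hUT using Nat.le_induction with
  | base =>
    refine ⟨by linarith, ?_⟩
    apply mul_le_mul_of_nonneg_left _ (Nat.cast_nonneg U)
    linarith
  | succ T _ ih =>
    obtain ⟨i1, i2⟩ := ih
    have k := main_gen T M hM
    have n' := pden_nonneg M (T+1)
    have hT : (0:ℝ) ≤ T := Nat.cast_nonneg T
    push_cast
    constructor
    · rcases n'.eq_or_lt with h0 | h0
      · rw [← h0] at k
        nlinarith
      · exact h0
    · have := mul_le_mul_of_nonneg_right i2 n'
      have : ((T:ℝ)+1)*(1 - pden M (T+1)) * pden M T ≤ U * pden M (T+1) * pden M T := by linarith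
      exact le_of_mul_le_mul_right this i1

end pebble

lemma uniformProb_eq (B : Type*) [Fintype B] (T : ℕ) (M : Set (B → ℕ)) :
    uniformProb B T M = pden M T := by
  classical
  have e : ((Fintype.piFinset fun _ : B => Finset.range (T + 1)).filter
        (fun f => (∑ b, f b) = T)) = lev B T := by
    ext f
    rw [mem_filter, mem_lev, Fintype.mem_piFinset]
    refine ⟨fun h => h.2, fun h => ⟨fun b => ?_, h⟩⟩
    rw [mem_range, Nat.lt_succ_iff, ← h]
    exact single_le_sum (f := f) (fun _ _ => Nat.zero_le _) (mem_univ b)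
  unfold uniformProb pden cnt
  rw [← card_filter, ← e, filter_filter]

theorem stmt_6 (B : Type*) [Fintype B] [Nonempty B] (M : Set (B → ℕ))
    (hM : ∀ x ∈ M, ∀ y : B → ℕ, x ≤ y → y ∈ M)
    (T U : ℕ) (hUT : U ≤ T) (h : uniformProb B U M ≥ 1 / 2) :
    uniformProb B T M ≥ (if T = 0 ∧ U = 0 then 1 else (T : ℝ) / (T + U)) := by
  classical
  rw [uniformProb_eq] at *
  split_ifs with h0
  · obtain ⟨rfl, rfl⟩ := h0
    rw [main_zero M hM (by intro h1; rw [h1] at h; norm_num at h) 0]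
  · obtain ⟨_, h2⟩ := chain M hM U T hUT h
    have hT : 0 < T := by omega
    have hT' : (0:ℝ) < T := by exact_mod_cast hT
    have hU : (0:ℝ) ≤ U := Nat.cast_nonneg U
    rw [ge_iff_le, div_le_iff₀ (by linarith)]
    linarith
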